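/- arXiv:2411.09416 — 4 statements merged into one kernel-verified Lean document; each statement's English description precedes it below -/
import Mathlib

section
/- Let R be a semi-local ring (i.e., R/J(R) is a semisimple ring) and n ≥ 1. Then R is a (2n−1)-ΔU ring if and only if R/J(R) is isomorphic (as a ring) to a finite direct product of finite fields F_{q₁} × ⋯ × F_{q_m} where each q_i is a prime power and (q_i − 1) divides 2n−1 for every i. -/
/-- `Δ(R)`: the set of elements `a` such that `1 - ua` is a unit for every unit `u`. -/
def Delta (R : Type*) [Ring R] : Set R :=
  {a : R | ∀ u : Rˣ, IsUnit (1 - (u : R) * a)}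

/-- A ring `R` is `n`-ΔU if `uⁿ - 1 ∈ Δ(R)` for every unit `u` of `R`. -/
def IsNDeltaU (R : Type*) [Ring R] (n : ℕ) : Prop :=
  ∀ u : Rˣ, ((u : R) ^ n - 1) ∈ Delta R

/-- The `n`-ΔU property descends along a ring homomorphism along which units lift. -/
theorem IsNDeltaU.of_units_lift {R S : Type*} [Ring R] [Ring S] {n : ℕ} (f : R →+* S)
    (hf : ∀ u : Sˣ, ∃ v : Rˣ, f v = u) (h : IsNDeltaU R n) : IsNDeltaU S n := by
  intro u w
  obtain ⟨u', hu⟩ := hf u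
  obtain ⟨w', hw⟩ := hf w
  simpa [hu, hw] using (h u' w').map f

/-- The quotient map by the Jacobson radical reflects units. -/
theorem isUnit_of_isUnit_mk_jacobson {R : Type*} [Ring R] {a : R}
    (h : IsUnit ((TwoSidedIdeal.jacobson (⊥ : TwoSidedIdeal R)).ringCon.mk' a)) : IsUnit a := by
  set J := TwoSidedIdeal.jacobson (⊥ : TwoSidedIdeal R)
  have left_inv : ∀ r : R, r - 1 ∈ J → ∃ s, s * r = 1 := by
    intro r hr
    obtain ⟨z, hz⟩ := TwoSidedIdeal.mem_jacobson_iff.1 hr 1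
    refine ⟨z, ?_⟩
    rw [TwoSidedIdeal.mem_bot] at hz
    rw [← sub_eq_zero, ← hz]
    noncomm_ring
  have isUnit_of : ∀ r : R, r - 1 ∈ J → IsUnit r := by
    intro r hr
    obtain ⟨s, hs⟩ := left_inv r hr
    have hs' : s - 1 ∈ J := by
      have : s - 1 = -(s * (r - 1)) := by rw [mul_sub, hs]; simp
      rw [this]
      exact J.neg_mem (J.mul_mem_left _ _ hr)
    obtain ⟨t, ht⟩ := left_inv s hs'
    have htr : t = r := by
      calc t = t * (s * r) := by rw [hs, mul_one]
        _ = r := by rw [← mul_assoc, ht, one_mul]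
    exact ⟨⟨r, s, htr ▸ ht, hs⟩, rfl⟩
  have eq_iff : ∀ x y : R, J.ringCon.mk' x = J.ringCon.mk' y ↔ x - y ∈ J := fun x y ↦
    (RingCon.eq J.ringCon).trans (J.rel_iff x y)
  obtain ⟨c, hc₁, hc₂⟩ := isUnit_iff_exists.1 h
  obtain ⟨b, rfl⟩ := RingCon.mk'_surjective J.ringCon c
  rw [← map_mul, ← map_one J.ringCon.mk', eq_iff] at hc₁ hc₂
  obtain ⟨u, hu⟩ := isUnit_of _ hc₁
  obtain ⟨v, hv⟩ := isUnit_of _ hc₂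
  refine isUnit_iff_exists_and_exists.2 ⟨⟨b * ↑u⁻¹, ?_⟩, ⟨↑v⁻¹ * b, ?_⟩⟩
  · rw [← mul_assoc, ← hu, Units.mul_inv]
  · rw [mul_assoc, ← hv, Units.inv_mul]

/-- In an `n`-ΔU ring with `n` odd, if `2` is a unit then the ring is trivial. -/
theorem IsNDeltaU.not_isUnit_two {S : Type*} [Ring S] [Nontrivial S] {n : ℕ} (hn : Odd n)
    (h : IsNDeltaU S n) : ¬ IsUnit (2 : S) := by
  rintro ⟨v, hv⟩
  have := h (-1) (-v⁻¹)
  have e : (1 : S) - ((-v⁻¹ : Sˣ) : S) * ((((-1 : Sˣ) : S)) ^ n - 1) = 0 := by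
    have h2 : (((-1 : Sˣ) : S)) ^ n - 1 = -(v : S) := by
      rw [Units.val_neg, Units.val_one, hn.neg_one_pow, hv]; norm_num
    rw [h2]; simp
  rw [e] at this
  exact not_isUnit_zero this

/-- A ring with `2 = 0` and a partial isometry `p` of square zero is not `n`-ΔU for odd `n`. -/
theorem not_isNDeltaU_of_square_zero {S : Type*} [Ring S] {n : ℕ} (hn : Odd n) (h2 : (2 : S) = 0)
    {p q : S} (hp : p * p = 0) (hq : q * q = 0) (hpq : p * q * p = p) (hp0 : p ≠ 0) :
    ¬ IsNDeltaU S n := by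
  intro h
  have hpp : (1 + p) * (1 + p) = 1 := by
    have : (1 + p) * (1 + p) = 1 + 2 * p + p * p := by noncomm_ring
    rw [this, h2, hp]; simp
  let u : Sˣ := ⟨1 + p, 1 + p, hpp, hpp⟩
  let w : Sˣ := ⟨1 + q, 1 - q, by
    have : (1 + q) * (1 - q) = 1 - q * q := by noncomm_ring
    rw [this, hq, sub_zero], by
    have : (1 - q) * (1 + q) = 1 - q * q := by noncomm_ring
    rw [this, hq, sub_zero]⟩
  have hu : (u : S) ^ n - 1 = p := by
    obtain ⟨k, rfl⟩ := hn
    have : (u : S) ^ 2 = 1 := by rw [pow_two]; exact hpp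
    rw [pow_succ, pow_mul, this, one_pow, one_mul]
    simp [u]
  have hunit := h u w
  rw [hu] at hunit
  have key : (1 - (w : S) * p) * ((w : S) * p) = 0 := by
    have hpw : p * (w : S) * p = p := by
      change p * (1 + q) * p = p
      rw [mul_add, mul_one, add_mul, hp, hpq, zero_add]
    calc (1 - (w : S) * p) * ((w : S) * p) = w * p - w * (p * w * p) := by noncomm_ring
      _ = 0 := by rw [hpw, sub_self]
  rw [hunit.mul_right_eq_zero, Units.mul_right_eq_zero] at key
  exact hp0 key

/-- A matrix ring over a division ring that is `n`-ΔU for an odd `n` has size at most one. -/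
theorem IsNDeltaU.matrix_size_eq_one {D : Type*} [DivisionRing D] {d n : ℕ} [NeZero d]
    (hn : Odd n) (h : IsNDeltaU (Matrix (Fin d) (Fin d) D) n) : d = 1 := by
  by_contra hd
  have hd2 : 2 ≤ d := by have := NeZero.ne d; omega
  let i : Fin d := ⟨0, by omega⟩
  let j : Fin d := ⟨1, by omega⟩
  have hij : i ≠ j := by simp [i, j]
  have h2D : (2 : D) = 0 := by
    by_contra h2
    refine h.not_isUnit_two hn ?_
    rw [← map_ofNat (Matrix.scalar (Fin d)) 2]
    exact (IsUnit.mk0 (2 : D) h2).map (Matrix.scalar (Fin d))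
  have h2 : (2 : Matrix (Fin d) (Fin d) D) = 0 := by
    rw [← map_ofNat (Matrix.scalar (Fin d)) 2, h2D, map_zero]
  refine not_isNDeltaU_of_square_zero (p := Matrix.single i j 1) (q := Matrix.single j i 1)
    hn h2 ?_ ?_ ?_ ?_ h
  · exact Matrix.single_mul_single_of_ne _ _ _ _ hij.symm _
  · exact Matrix.single_mul_single_of_ne _ _ _ _ hij _
  · simp
  · intro h0
    simpa using congrFun (congrFun h0 i) j

/-- Units of an `n`-ΔU division ring are killed by the exponent `n`. -/
theorem IsNDeltaU.pow_eq_one {D : Type*} [DivisionRing D] {n : ℕ} (h : IsNDeltaU D n)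
    {a : D} (ha : a ≠ 0) : a ^ n = 1 := by
  by_contra hne
  have hne' : a ^ n - 1 ≠ 0 := sub_ne_zero.2 hne
  have := h (Units.mk0 a ha) (Units.mk0 _ hne')⁻¹
  simp [hne'] at this

/-- If `a` has finite order `j`, invertible in the division ring, and does not commute with `x`,
then some element not commuting with `a` normalizes the cyclic group generated by `a`. -/
theorem exists_normalizing_not_commute {D : Type*} [DivisionRing D] {a x : D}
    (ha : a ≠ 0) (hj : (orderOf a : D) ≠ 0) (hax : a * x ≠ x * a) :
    ∃ (y : D) (m : ℕ), a * y = a ^ m * y * a ∧ a * y ≠ y * a := by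
  set j := orderOf a
  have haj : a ^ j = 1 := pow_orderOf_eq_one a
  have hbj : a⁻¹ ^ j = 1 := by rw [inv_pow, haj, inv_one]
  let f : ℕ → ℕ → D := fun i l ↦ a⁻¹ ^ (i * l) * (a ^ l * x * a⁻¹ ^ l)
  let y : ℕ → D := fun i ↦ ∑ l ∈ Finset.range j, f i l
  have shift : ∀ i, a * y i = a ^ i * y i * a := by
    intro i
    have h1 : ∀ l, a * f i l = a ^ i * f i (l + 1) * a := by
      intro l
      have c : a ^ i * a⁻¹ ^ (i * (l + 1)) = a⁻¹ ^ (i * l) := by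
        rw [mul_add, mul_one, add_comm, pow_add, ← mul_assoc, inv_pow,
          mul_inv_cancel₀ (pow_ne_zero i ha), one_mul]
      have c' : a * a⁻¹ ^ (i * l) = a⁻¹ ^ (i * l) * a :=
        ((Commute.refl a).inv_right₀.pow_right _)
      calc a * f i l = (a * a⁻¹ ^ (i * l)) * (a ^ l * x * a⁻¹ ^ l) := by
            simp only [f, mul_assoc]
        _ = a⁻¹ ^ (i * l) * (a ^ (l + 1) * x * a⁻¹ ^ l) := by
            rw [c', pow_succ' a l]; simp only [mul_assoc]
        _ = (a ^ i * a⁻¹ ^ (i * (l + 1))) * (a ^ (l + 1) * x * (a⁻¹ ^ (l + 1) * a)) := by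
            rw [c, pow_succ a⁻¹ l, mul_assoc (a⁻¹ ^ l), inv_mul_cancel₀ ha, mul_one]
        _ = a ^ i * f i (l + 1) * a := by simp only [f, mul_assoc]
    have h2 : ∑ l ∈ Finset.range j, f i (l + 1) = y i := by
      have h3 := Finset.sum_range_succ (f i) j
      rw [Finset.sum_range_succ'] at h3
      have h4 : f i j = f i 0 := by
        simp only [f, pow_mul, pow_right_comm a⁻¹ i j, haj, hbj, one_pow, pow_zero]
      rw [h4] at h3
      exact add_right_cancel h3
    calc a * y i = ∑ l ∈ Finset.range j, a ^ i * f i (l + 1) * a := by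
          rw [Finset.mul_sum]; exact Finset.sum_congr rfl fun l _ ↦ h1 l
      _ = a ^ i * y i * a := by rw [← Finset.sum_mul, ← Finset.mul_sum, h2]
  have total : ∑ i ∈ Finset.range j, y i = j * x := by
    have hj0 : 0 < j := Nat.pos_of_ne_zero fun h ↦ hj (by rw [h]; simp)
    simp only [y]
    rw [Finset.sum_comm]
    rw [Finset.sum_eq_single_of_mem 0 (Finset.mem_range.2 hj0)]
    · simp [f]
    · intro l hl hl0
      have hne : a⁻¹ ^ l ≠ 1 := by
        rw [inv_pow, ne_eq, inv_eq_one]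
        exact pow_ne_one_of_lt_orderOf hl0 (Finset.mem_range.1 hl)
      have hs : ∑ i ∈ Finset.range j, a⁻¹ ^ (i * l) = 0 := by
        have := mul_geom_sum (a⁻¹ ^ l) j
        rw [← pow_mul, mul_comm l j, pow_mul, hbj, one_pow, sub_self] at this
        have := (mul_eq_zero.1 this).resolve_left (sub_ne_zero.2 hne)
        simpa only [← pow_mul, mul_comm l] using this
      simp only [f]
      rw [← Finset.sum_mul, hs, zero_mul]
  by_contra! hcon
  have hy : ∀ i, a * y i = y i * a := fun i ↦ hcon _ i (shift i)
  have hjx : a * (j * x) = j * x * a := by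
    rw [← total, Finset.mul_sum, Finset.sum_mul]
    exact Finset.sum_congr rfl fun i _ ↦ hy i
  apply hax
  rw [← mul_assoc, ← Nat.cast_comm, mul_assoc, mul_assoc] at hjx
  exact mul_left_cancel₀ hj hjx

/-- If two elements of finite exponent satisfy a skew-commutation relation, the monoid they generate
is finite. -/
theorem finite_closure_pair {M : Type*} [Monoid M] {a y : M} {k m : ℕ} (hk : 0 < k)
    (ha : a ^ k = 1) (hy : y ^ k = 1) (h : y * a = a ^ m * y) :
    (Submonoid.closure {a, y} : Set M).Finite := by
  have hfin : (Set.range fun t : Fin k × Fin k ↦ a ^ (t.1 : ℕ) * y ^ (t.2 : ℕ)).Finite :=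
    Set.finite_range _
  refine hfin.subset fun z hz ↦ ?_
  have comm : ∀ i, y * a ^ i = a ^ (m * i) * y := by
    intro i
    have : SemiconjBy y a (a ^ m) := h
    simpa [pow_mul] using (this.pow_right i).eq
  obtain ⟨i, l, rfl⟩ : ∃ i l : ℕ, z = a ^ i * y ^ l := by
    induction hz using Submonoid.closure_induction_left with
    | one => exact ⟨0, 0, by simp⟩
    | mul_left s hs t _ ih =>
      obtain ⟨i, l, rfl⟩ := ih
      rcases hs with rfl | rfl
      · exact ⟨i + 1, l, by rw [pow_succ', mul_assoc]⟩
      · exact ⟨m * i, l + 1, by rw [← mul_assoc, comm, pow_succ', mul_assoc]⟩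
  refine ⟨(⟨i % k, Nat.mod_lt _ hk⟩, ⟨l % k, Nat.mod_lt _ hk⟩), ?_⟩
  simp only
  rw [← pow_eq_pow_mod i ha, ← pow_eq_pow_mod l hy]

/-- A division ring whose unit group has odd exponent is commutative. -/
theorem DivisionRing.mul_comm_of_odd_exponent {D : Type*} [DivisionRing D] {k : ℕ} (hk : Odd k)
    (h : ∀ a : D, a ≠ 0 → a ^ k = 1) (a x : D) : a * x = x * a := by
  by_contra hax
  have ha : a ≠ 0 := by rintro rfl; simp at hax
  have h2 : (2 : D) = 0 := by
    have := h (-1) (by simp)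
    rw [hk.neg_one_pow] at this
    calc (2 : D) = 1 + 1 := one_add_one_eq_two.symm
      _ = -1 + 1 := by rw [this]
      _ = 0 := neg_add_cancel 1
  have : CharP D 2 := CharTwo.of_one_ne_zero_of_two_eq_zero one_ne_zero h2
  have hj : (orderOf a : D) ≠ 0 := by
    rw [ne_eq, CharP.cast_eq_zero_iff D 2]
    intro h2j
    exact hk.not_two_dvd_nat (h2j.trans (orderOf_dvd_of_pow_eq_one (h a ha)))
  obtain ⟨y, m, hy, hne⟩ := exists_normalizing_not_commute ha hj hax
  have hy0 : y ≠ 0 := by rintro rfl; simp at hne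
  have hskew : y * a = a ^ (m * (k - 1) + 1) * y := by
    have h1 : a ^ (m * (k - 1)) * a ^ m = 1 := by
      rw [← pow_add, ← Nat.mul_add_one, Nat.sub_add_cancel hk.pos, mul_comm, pow_mul, h a ha,
        one_pow]
    rw [pow_succ, mul_assoc, hy, mul_assoc (a ^ m), ← mul_assoc, h1, one_mul]
  have hfin := finite_closure_pair hk.pos (h a ha) (h y hy0) hskew
  let _ : Algebra (ZMod 2) D := ZMod.algebra D 2
  let A := Algebra.adjoin (ZMod 2) ({a, y} : Set D)
  have hspan : Subalgebra.toSubmodule A =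
      Submodule.span (ZMod 2) (Submonoid.closure ({a, y} : Set D)) := Algebra.adjoin_eq_span _ _
  have hmod : Module.Finite (ZMod 2) (Subalgebra.toSubmodule A) := by
    rw [hspan]
    exact Module.Finite.span_of_finite _ hfin
  have hmod' : Module.Finite (ZMod 2) A := hmod
  have : Finite A := Module.finite_of_finite (ZMod 2)
  have hfield := Finite.isDomain_to_isField A
  have := hfield.mul_comm ⟨a, Algebra.subset_adjoin (by simp)⟩
    ⟨y, Algebra.subset_adjoin (by simp)⟩
  exact hne (congrArg Subtype.val this)

/-- A division ring that is `n`-ΔU for an odd `n` is a finite field whose unit group has order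
dividing `n`. -/
theorem IsNDeltaU.exists_ringEquiv_finite_field {D : Type*} [DivisionRing D] {k : ℕ} (hk : Odd k)
    (h : IsNDeltaU D k) :
    ∃ (F : Type) (_ : Field F) (_ : Fintype F),
      (Nat.card F - 1) ∣ k ∧ Nonempty (D ≃+* F) := by
  have hpow : ∀ a : D, a ≠ 0 → a ^ k = 1 := fun a ha ↦ h.pow_eq_one ha
  let _ : Field D :=
    { ‹DivisionRing D› with mul_comm := DivisionRing.mul_comm_of_odd_exponent hk hpow }
  have hu : ∀ u : Dˣ, u ^ k = 1 := fun u ↦ Units.ext (by simpa using hpow u u.ne_zero)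
  have : NeZero k := ⟨hk.pos.ne'⟩
  have hfu : Finite Dˣ := by
    have htop : rootsOfUnity k D = ⊤ := by
      ext u; simpa [mem_rootsOfUnity] using hu u
    have : Finite (⊤ : Subgroup Dˣ) := htop ▸ (inferInstance : Finite (rootsOfUnity k D))
    exact Finite.of_equiv _ Subgroup.topEquiv.toEquiv
  have hfin : Finite D := by
    have : (Set.univ : Set D) ⊆ insert 0 (Set.range ((↑) : Dˣ → D)) := fun a _ ↦ by
      by_cases ha : a = 0
      · exact Or.inl ha
      · exact Or.inr ⟨Units.mk0 a ha, rfl⟩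
    exact Set.finite_univ_iff.1 (((Set.finite_range _).insert 0).subset this)
  have hcard : (Nat.card D - 1) ∣ k := by
    rw [← Nat.card_units, ← IsCyclic.exponent_eq_card]
    exact Monoid.exponent_dvd_of_forall_pow_eq_one hu
  refine ⟨Shrink.{0} D, inferInstance, Fintype.ofFinite _, ?_, ⟨(Shrink.ringEquiv.{0} D).symm⟩⟩
  rwa [Nat.card_congr (equivShrink.{0} D).symm]

/-- For a semi-local ring `R` (i.e. `R/J(R)` is semisimple), `R` is `(2n-1)`-ΔU iff
`R/J(R)` is isomorphic to a finite direct product of finite fields `F_{qᵢ}` with each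
`qᵢ` a prime power and `qᵢ - 1` dividing `2n - 1`. -/
theorem semilocal_isNDeltaU_iff (R : Type*) [Ring R] (n : ℕ) (hn : 1 ≤ n)
    (hsl : IsSemisimpleRing
      (TwoSidedIdeal.jacobson (⊥ : TwoSidedIdeal R)).ringCon.Quotient) :
    IsNDeltaU R (2 * n - 1) ↔
      ∃ (m : ℕ) (F : Fin m → Type) (_ : ∀ i, Field (F i)) (_ : ∀ i, Fintype (F i)),
        (∀ i, IsPrimePow (Nat.card (F i))) ∧
        (∀ i, (Nat.card (F i) - 1) ∣ (2 * n - 1)) ∧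
        Nonempty
          ((TwoSidedIdeal.jacobson (⊥ : TwoSidedIdeal R)).ringCon.Quotient ≃+*
            ∀ i, F i) := by
  have hodd : Odd (2 * n - 1) := ⟨n - 1, by omega⟩
  set J := TwoSidedIdeal.jacobson (⊥ : TwoSidedIdeal R)
  constructor
  · intro h
    have hQ : IsNDeltaU J.ringCon.Quotient (2 * n - 1) := by
      refine h.of_units_lift J.ringCon.mk' fun u ↦ ?_
      obtain ⟨a, ha⟩ := RingCon.mk'_surjective J.ringCon (u : J.ringCon.Quotient)
      obtain ⟨v, hv⟩ := isUnit_of_isUnit_mk_jacobson (a := a) (by rw [ha]; exact u.isUnit)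
      exact ⟨v, by rw [hv, ha]⟩
    obtain ⟨m, D, d, _, hd, ⟨e⟩⟩ :=
      IsSemisimpleRing.exists_ringEquiv_pi_matrix_divisionRing J.ringCon.Quotient
    have hM : ∀ i, IsNDeltaU (Matrix (Fin (d i)) (Fin (d i)) (D i)) (2 * n - 1) := by
      intro i
      refine hQ.of_units_lift ((Pi.evalRingHom _ i).comp e.toRingHom) fun u ↦ ?_
      refine ⟨Units.map e.symm.toMonoidHom (MulEquiv.piUnits.symm (Pi.mulSingle i u)), ?_⟩
      simp
    have hone : ∀ i, d i = 1 := fun i ↦ (hM i).matrix_size_eq_one hodd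
    obtain rfl : d = fun _ ↦ 1 := funext hone
    have hD : ∀ i, IsNDeltaU (D i) (2 * n - 1) := by
      intro i
      let ε : Matrix (Fin 1) (Fin 1) (D i) ≃+* D i := Matrix.uniqueRingEquiv
      refine (hM i).of_units_lift ε.toRingHom fun u ↦ ⟨Units.map ε.symm.toMonoidHom u, ?_⟩
      simp
    choose F hF hFfin hdvd hequiv using fun i ↦ (hD i).exists_ringEquiv_finite_field hodd
    refine ⟨m, F, hF, hFfin, fun i ↦ ?_, hdvd, ⟨?_⟩⟩
    · rw [Nat.card_eq_fintype_card]
      exact Fintype.isPrimePow_card_of_field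
    · exact e.trans (RingEquiv.piCongrRight fun i ↦
        (Matrix.uniqueRingEquiv : Matrix (Fin 1) (Fin 1) (D i) ≃+* D i).trans (hequiv i).some)
  · rintro ⟨m, F, _, _, -, hdvd, ⟨e⟩⟩ u w
    apply isUnit_of_isUnit_mk_jacobson
    have hu : J.ringCon.mk' (u : R) ^ (2 * n - 1) = 1 := by
      apply e.injective
      rw [map_pow, map_one]
      funext i
      have hne : e (J.ringCon.mk' (u : R)) i ≠ 0 :=
        (((u.isUnit.map J.ringCon.mk').map e).map (Pi.evalRingHom F i)).ne_zero
      obtain ⟨c, hc⟩ := hdvd i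
      rw [Nat.card_eq_fintype_card] at hc
      rw [Pi.pow_apply, Pi.one_apply, hc, pow_mul, FiniteField.pow_card_sub_one_eq_one _ hne,
        one_pow]
    rw [map_sub, map_mul, map_sub, map_pow, hu]
    simp
end

section
/- Let R be a ring and n ≥ 1. The following are equivalent: (i) R is von Neumann regular and (2n−1)-ΔU; (ii) R is strongly regular and (2n−1)-ΔU; (iii) R is unit-regular and (2n−1)-ΔU; (iv) R satisfies the identity x^{2n} = x for all x ∈ R. -/
/-- A ring is (von Neumann) regular if every `a` satisfies `a = a * x * a` for some `x`. -/
def IsVNRegularRing (R : Type*) [Ring R] : Prop :=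
  ∀ a : R, ∃ x : R, a * x * a = a

/-- A ring is strongly regular if `a ∈ a² * R` for every `a`. -/
def IsStronglyRegularRing (R : Type*) [Ring R] : Prop :=
  ∀ a : R, ∃ x : R, a = a ^ 2 * x

/-- A ring is unit-regular if every `a` satisfies `a = a * u * a` for some unit `u`. -/
def IsUnitRegularRing (R : Type*) [Ring R] : Prop :=
  ∀ a : R, ∃ u : Rˣ, a * (u : R) * a = a

section Delta

variable {R : Type*} [Ring R]

theorem add_mem_Delta {a b : R} (ha : a ∈ Delta R) (hb : b ∈ Delta R) : a + b ∈ Delta R := by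
  intro u
  obtain ⟨v, hv⟩ := ha u
  have h := v.isUnit.mul (hb (v⁻¹ * u))
  convert h using 1
  rw [mul_sub, mul_one, Units.val_mul, mul_assoc, v.mul_inv_cancel_left, hv]
  noncomm_ring

theorem unit_mul_mem_Delta {a : R} (ha : a ∈ Delta R) (v : Rˣ) : (v : R) * a ∈ Delta R := by
  intro u
  simpa [mul_assoc] using ha (u * v)

theorem neg_mem_Delta {a : R} (ha : a ∈ Delta R) : -a ∈ Delta R := by
  simpa using unit_mul_mem_Delta ha (-1)

theorem zero_mem_Delta : (0 : R) ∈ Delta R := fun _ ↦ by simp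

theorem nsmul_mem_Delta {a : R} (ha : a ∈ Delta R) (k : ℕ) : k • a ∈ Delta R := by
  induction k with
  | zero => simpa using zero_mem_Delta
  | succ k ih => rw [succ_nsmul]; exact add_mem_Delta ih ha

theorem eq_zero_of_isIdempotentElem_of_isUnit_one_sub {e : R} (he : e * e = e)
    (hu : IsUnit (1 - e)) : e = 0 :=
  hu.mul_left_cancel (by rw [sub_mul, he]; simp)

/-- In a unit-regular ring `Δ(R) = 0`. -/
theorem IsUnitRegularRing.eq_zero_of_mem_Delta (h : IsUnitRegularRing R) {a : R}
    (ha : a ∈ Delta R) : a = 0 := by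
  obtain ⟨u, hu⟩ := h a
  have : (u : R) * a = 0 :=
    eq_zero_of_isIdempotentElem_of_isUnit_one_sub (by rw [mul_assoc, ← mul_assoc a, hu]) (ha u)
  simpa using this

theorem IsNDeltaU.two_mem_Delta {m : ℕ} (hm : Odd m) (h : IsNDeltaU R m) : (2 : R) ∈ Delta R := by
  have := neg_mem_Delta (h (-1))
  rw [Units.val_neg, Units.val_one, hm.neg_one_pow] at this
  norm_num at this
  exact this

theorem one_add_pow_of_sq_zero {a : R} (ha : a * a = 0) (k : ℕ) :
    (1 + a) ^ k = 1 + k • a := by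
  induction k with
  | zero => simp
  | succ k ih =>
    rw [pow_succ, ih, add_mul, one_mul, smul_mul_assoc, mul_add, mul_one, ha, add_zero, succ_nsmul]
    abel

theorem IsNDeltaU.mem_Delta_of_sq_zero {m : ℕ} (hm : Odd m) (h : IsNDeltaU R m) {a : R}
    (ha : a * a = 0) : a ∈ Delta R := by
  let u : Rˣ := ⟨1 + a, 1 - a, by simp [add_mul, mul_sub, ha], by simp [sub_mul, mul_add, ha]⟩
  have h1 : m • a ∈ Delta R := by
    have := h u
    change (1 + a) ^ m - 1 ∈ Delta R at this
    rwa [one_add_pow_of_sq_zero ha, add_sub_cancel_left] at this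
  have h2 : (2 : ℕ) • a ∈ Delta R := by
    have h3 := add_mem_Delta (unit_mul_mem_Delta (h.two_mem_Delta hm) u)
      (neg_mem_Delta (h.two_mem_Delta hm))
    convert h3 using 1
    change _ = (1 + a) * 2 + -2
    rw [add_mul, one_mul, mul_two, two_nsmul]
    abel
  obtain ⟨k, rfl⟩ := hm
  have h3 := add_mem_Delta h1 (neg_mem_Delta (nsmul_mem_Delta h2 k))
  convert h3 using 1
  rw [add_nsmul, mul_nsmul, one_nsmul]
  abel

/-- A square-zero element with a square-zero reflexive inverse generates a system of `2 × 2`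
matrix units, whose transposition unit prevents it from lying in `Δ(R)` unless it is zero. -/
theorem eq_zero_of_mem_Delta_of_sq_zero {a y : R} (haa : a * a = 0) (hyy : y * y = 0)
    (haya : a * y * a = a) (hyay : y * a * y = y) (ha : a ∈ Delta R) : a = 0 := by
  have hw : (a + y + (1 - a * y - y * a)) * (a + y + (1 - a * y - y * a)) = 1 := by
    have e1 : a * (y * a) = a := by rw [← mul_assoc, haya]
    have e2 : y * (a * y) = y := by rw [← mul_assoc, hyay]
    have e3 (z : R) : a * (a * z) = 0 := by rw [← mul_assoc, haa, zero_mul]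
    have e4 (z : R) : y * (y * z) = 0 := by rw [← mul_assoc, hyy, zero_mul]
    simp only [mul_add, add_mul, mul_sub, sub_mul, mul_one, one_mul, mul_assoc, haa, hyy, e1, e2,
      e3, e4, mul_zero]
    abel
  have hf := ha ⟨_, _, hw, hw⟩
  have hwa : (a + y + (1 - a * y - y * a)) * a = y * a := by
    simp only [add_mul, sub_mul, one_mul, haa, haya, mul_assoc y a a, mul_zero]
    abel
  change IsUnit (1 - (a + y + (1 - a * y - y * a)) * a) at hf
  rw [hwa] at hf
  have hya : y * a = 0 :=
    eq_zero_of_isIdempotentElem_of_isUnit_one_sub (by rw [← mul_assoc, hyay]) hf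
  rw [← haya, mul_assoc, hya, mul_zero]

theorem IsVNRegularRing.eq_zero_of_sq_zero {m : ℕ} (hm : Odd m) (hR : IsVNRegularRing R)
    (h : IsNDeltaU R m) {a : R} (ha : a * a = 0) : a = 0 := by
  obtain ⟨x, hx⟩ := hR a
  have e1 : a * (x * a) = a := by rw [← mul_assoc, hx]
  have e2 (z : R) : a * (x * (a * z)) = a * z := by rw [← mul_assoc, ← mul_assoc, hx]
  have e3 (z : R) : a * (a * z) = 0 := by rw [← mul_assoc, ha, zero_mul]
  refine eq_zero_of_mem_Delta_of_sq_zero (y := (1 - a * x) * (x * a * x)) ha ?_ ?_ ?_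
    (h.mem_Delta_of_sq_zero hm ha) <;>
  · simp only [mul_sub, sub_mul, one_mul, mul_assoc, e1, e2, e3, mul_zero, zero_mul]
    abel

end Delta

section Reduced

variable {R : Type*} [Ring R]

theorem commute_of_isIdempotentElem_of_reduced (hred : ∀ a : R, a * a = 0 → a = 0) {e : R}
    (he : e * e = e) (r : R) : e * r = r * e := by
  have e1 (z : R) : e * (e * z) = e * z := by rw [← mul_assoc, he]
  have h1 : e * r - e * r * e = 0 := hred _ (by
    simp only [mul_sub, sub_mul, mul_assoc, e1]; abel)
  have h2 : r * e - e * r * e = 0 := hred _ (by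
    simp only [mul_sub, sub_mul, mul_assoc, e1]; abel)
  rw [sub_eq_zero.mp h1, sub_eq_zero.mp h2]

theorem IsVNRegularRing.isStronglyRegularRing (hR : IsVNRegularRing R)
    (hred : ∀ a : R, a * a = 0 → a = 0) : IsStronglyRegularRing R := by
  intro a
  obtain ⟨x, hx⟩ := hR a
  have e1 : a * (x * a) = a := by rw [← mul_assoc, hx]
  have e2 (z : R) : a * (x * (a * z)) = a * z := by rw [← mul_assoc, ← mul_assoc, hx]
  refine ⟨x, sub_eq_zero.mp (hred _ ?_)⟩
  simp only [pow_two, mul_sub, sub_mul, mul_assoc, e1, e2]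
  abel

theorem IsStronglyRegularRing.eq_zero_of_sq_zero (hR : IsStronglyRegularRing R) {a : R}
    (ha : a * a = 0) : a = 0 := by
  obtain ⟨x, hx⟩ := hR a
  rw [hx, pow_two, ha, zero_mul]

theorem IsStronglyRegularRing.isVNRegularRing (hR : IsStronglyRegularRing R) :
    IsVNRegularRing R := by
  intro a
  obtain ⟨x, hx⟩ := hR a
  have e1 : a * (a * x) = a := by rw [← mul_assoc, ← pow_two, ← hx]
  have e2 (z : R) : a * (a * (x * z)) = a * z := by rw [← mul_assoc a x, ← mul_assoc, e1]
  refine ⟨x, sub_eq_zero.mp (hR.eq_zero_of_sq_zero ?_)⟩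
  simp only [mul_sub, sub_mul, mul_assoc, e2]
  abel

theorem IsStronglyRegularRing.isUnitRegularRing (hR : IsStronglyRegularRing R) :
    IsUnitRegularRing R := by
  intro a
  obtain ⟨x, hx⟩ := hR.isVNRegularRing a
  have hc {e : R} (he : e * e = e) (r : R) : e * r = r * e :=
    commute_of_isIdempotentElem_of_reduced (fun _ ↦ hR.eq_zero_of_sq_zero) he r
  have he : a * x * (a * x) = a * x := by rw [← mul_assoc, hx]
  have hf : x * a * (x * a) = x * a := by rw [mul_assoc, ← mul_assoc a, hx]
  have hcomm : x * a = a * x := calc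
    x * a = x * (a * x * a) := by rw [hx]
    _ = x * a * (a * x) := by rw [hc he, mul_assoc]
    _ = a * (x * a) * x := by rw [← mul_assoc, hc hf]
    _ = a * x := by rw [← mul_assoc a, hx]
  have hae : a * (a * x) = a := by rw [← hc he, hx]
  let u : Rˣ :=
    ⟨x * (a * x) + (1 - a * x), a + (1 - a * x), by
      have h1 : x * (a * x) * a = a * x := by rw [mul_assoc, hx, hcomm]
      have h2 : x * (a * x) * (1 - a * x) = 0 := by rw [mul_assoc, mul_sub, he]; simp
      have h3 : (1 - a * x) * a = 0 := by rw [sub_mul, hx]; simp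
      have h4 : (1 - a * x) * (1 - a * x) = 1 - a * x := by
        rw [sub_mul, mul_sub, mul_sub, he]; simp
      rw [mul_add, add_mul, add_mul, h1, h2, h3, h4]; abel, by
      have h1 : a * (x * (a * x)) = a * x := by rw [← mul_assoc, he]
      have h2 : (1 - a * x) * (x * (a * x)) = 0 := by
        rw [← hc he x, ← mul_assoc, sub_mul, he]; simp
      have h3 : a * (1 - a * x) = 0 := by rw [mul_sub, hae]; simp
      have h4 : (1 - a * x) * (1 - a * x) = 1 - a * x := by
        rw [sub_mul, mul_sub, mul_sub, he]; simp
      rw [mul_add, add_mul, add_mul, h1, h2, h3, h4]; abel⟩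
  refine ⟨u, ?_⟩
  change a * (x * (a * x) + (1 - a * x)) * a = a
  rw [mul_add, ← mul_assoc a x, he, mul_sub, hae]
  simp [hx]

theorem IsUnitRegularRing.pow_succ_eq_self {m : ℕ} (hR : IsUnitRegularRing R)
    (hred : ∀ a : R, a * a = 0 → a = 0) (h : IsNDeltaU R m) (hm : m ≠ 0) (a : R) :
    a ^ (m + 1) = a := by
  obtain ⟨u, hu⟩ := hR a
  have he : (u : R) * a * (u * a) = u * a := by rw [mul_assoc, ← mul_assoc a, hu]
  have hpow : ((u⁻¹ : Rˣ) : R) ^ m = 1 := sub_eq_zero.mp (hR.eq_zero_of_mem_Delta (h u⁻¹))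
  have hcomm : Commute ((u⁻¹ : Rˣ) : R) (u * a) :=
    (commute_of_isIdempotentElem_of_reduced hred he _).symm
  have ham : a ^ m = u * a := calc
    a ^ m = (((u⁻¹ : Rˣ) : R) * (u * a)) ^ m := by rw [u.inv_mul_cancel_left]
    _ = u * a := by rw [hcomm.mul_pow, hpow, one_mul, IsIdempotentElem.pow_eq he hm]
  rw [pow_succ', ham, ← mul_assoc, hu]

end Reduced

/-- For a ring `R` and `n ≥ 1`, the following are equivalent:
(i) `R` is regular and `(2n-1)`-ΔU; (ii) `R` is strongly regular and `(2n-1)`-ΔU;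
(iii) `R` is unit-regular and `(2n-1)`-ΔU; (iv) `R` satisfies `x ^ (2n) = x`. -/
theorem regular_isNDeltaU_tfae' (R : Type*) [Ring R] (n : ℕ) (hn : 1 ≤ n) :
    List.TFAE
      [IsVNRegularRing R ∧ IsNDeltaU R (2 * n - 1),
       IsStronglyRegularRing R ∧ IsNDeltaU R (2 * n - 1),
       IsUnitRegularRing R ∧ IsNDeltaU R (2 * n - 1),
       ∀ x : R, x ^ (2 * n) = x] := by
  have hodd : Odd (2 * n - 1) := ⟨n - 1, by omega⟩
  have hsr : IsVNRegularRing R → IsNDeltaU R (2 * n - 1) → IsStronglyRegularRing R :=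
    fun h hd ↦ h.isStronglyRegularRing fun _ ↦ h.eq_zero_of_sq_zero hodd hd
  tfae_have 1 → 2 := fun ⟨h, hd⟩ ↦ ⟨hsr h hd, hd⟩
  tfae_have 2 → 3 := fun ⟨h, hd⟩ ↦ ⟨h.isUnitRegularRing, hd⟩
  tfae_have 3 → 1 := fun ⟨h, hd⟩ ↦ ⟨fun a ↦ (h a).imp' _ fun _ hu ↦ hu, hd⟩
  tfae_have 1 → 4 := fun ⟨h, hd⟩ x ↦ by
    have := (hsr h hd).isUnitRegularRing.pow_succ_eq_self
      (fun _ ↦ h.eq_zero_of_sq_zero hodd hd) hd (by omega) x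
    rwa [Nat.sub_add_cancel (by omega)] at this
  tfae_have 4 → 1 := fun h ↦ by
    refine ⟨fun a ↦ ⟨a ^ (2 * n - 2), ?_⟩, fun u ↦ ?_⟩
    · rw [← pow_succ', ← pow_succ, show 2 * n - 2 + 1 + 1 = 2 * n by omega, h]
    · have hu : (u : R) ^ (2 * n - 1) = 1 := by
        apply u.isUnit.mul_left_cancel
        rw [← pow_succ', Nat.sub_add_cancel (by omega), h, mul_one]
      rw [hu, sub_self]
      exact zero_mem_Delta
  tfae_finish
end

section
/- Let k ≥ 1 be a fixed integer. A ring R is a ΔU ring (i.e., U(R) = 1 + Δ(R)) if and only if the following three conditions hold: (i) 2 ∈ Δ(R); (ii) R is a 2^k-ΔU ring; (iii) for every x ∈ R, if x^{2^k} ∈ Δ(R) then x ∈ Δ(R). -/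
/-- A ring `R` is ΔU if `U(R) = 1 + Δ(R)`, i.e. `x` is a unit iff `x - 1 ∈ Δ(R)`. -/
def IsDeltaURing (R : Type*) [Ring R] : Prop :=
  ∀ x : R, IsUnit x ↔ x - 1 ∈ Delta R

/-- `Δ(R)` as an additive subgroup of `R`. -/
def deltaAddSubgroup (R : Type*) [Ring R] : AddSubgroup R where
  carrier := Delta R
  zero_mem' := fun u => by simp
  neg_mem' := fun {a} ha u => by simpa using ha (-u)
  add_mem' := fun {a b} ha hb u => by
    obtain ⟨v, hv⟩ := ha u
    have h : 1 - (u : R) * (a + b) = v * (1 - ((v⁻¹ * u : Rˣ) : R) * b) := by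
      rw [mul_sub, Units.val_mul, mul_assoc, Units.mul_inv_cancel_left, hv]
      noncomm_ring
    rw [h]
    exact v.isUnit.mul (hb _)

theorem Delta.units_mul_mem {R : Type*} [Ring R] {a : R} (ha : a ∈ Delta R) (v : Rˣ) :
    (v : R) * a ∈ Delta R := fun u => by
  simpa [mul_assoc] using ha (u * v)

theorem Delta.aeval_mul_mem {R : Type*} [Ring R] {a : R} (ha : a ∈ Delta R)
    (u : Rˣ) (q : Polynomial ℤ) : Polynomial.aeval (u : R) q * a ∈ Delta R := by
  change _ ∈ deltaAddSubgroup R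
  rw [Polynomial.aeval_eq_sum_range, Finset.sum_mul]
  refine AddSubgroup.sum_mem _ fun i _ => ?_
  rw [smul_mul_assoc, ← Units.val_pow_eq_pow_val]
  exact AddSubgroup.zsmul_mem (deltaAddSubgroup R) (Delta.units_mul_mem ha (u ^ i)) _

theorem exists_sub_one_pow_two_pow_eq (k : ℕ) (hk : 1 ≤ k) :
    ∃ q : Polynomial ℤ, (Polynomial.X - 1) ^ 2 ^ k = Polynomial.X ^ 2 ^ k - 1 + q * 2 := by
  obtain ⟨r, hr⟩ := exists_add_pow_prime_pow_eq Nat.prime_two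
    (Polynomial.X : Polynomial ℤ) (-1) k
  refine ⟨1 - Polynomial.X * r, ?_⟩
  rw [sub_eq_add_neg, hr, (even_two.pow_of_ne_zero (by lia : k ≠ 0)).neg_one_pow]
  push_cast
  ring

/-- For `k ≥ 1`, a ring `R` is ΔU iff (i) `2 ∈ Δ(R)`, (ii) `R` is `2^k`-ΔU, and
(iii) `x ^ (2^k) ∈ Δ(R)` implies `x ∈ Δ(R)`. -/
theorem isDeltaU_iff (R : Type*) [Ring R] (k : ℕ) (hk : 1 ≤ k) :
    IsDeltaURing R ↔
      ((2 : R) ∈ Delta R ∧ IsNDeltaU R (2 ^ k) ∧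
        ∀ x : R, x ^ (2 ^ k) ∈ Delta R → x ∈ Delta R) := by
  constructor
  · intro h
    refine ⟨?_, fun u => ?_, fun x hx => ?_⟩
    · have h2 := (deltaAddSubgroup R).neg_mem ((h (-1)).1 isUnit_one.neg)
      rwa [neg_sub, sub_neg_eq_add, one_add_one_eq_two] at h2
    · exact (h _).1 (u.isUnit.pow _)
    · have h1 : IsUnit (1 - x ^ 2 ^ k) := by simpa using hx 1
      rw [← mul_neg_geom_sum] at h1
      have hc : Commute (1 - x) (∑ i ∈ Finset.range (2 ^ k), x ^ i) := by
        rw [Commute, SemiconjBy, mul_neg_geom_sum, geom_sum_mul_neg]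
      have h3 := (deltaAddSubgroup R).neg_mem ((h _).1 (hc.isUnit_mul_iff.1 h1).1)
      rwa [neg_sub, sub_sub_cancel] at h3
  · rintro ⟨h2, hn, hr⟩ x
    constructor
    · rintro ⟨u, rfl⟩
      apply hr
      obtain ⟨q, hq⟩ := exists_sub_one_pow_two_pow_eq k hk
      have hu := congrArg (Polynomial.aeval (u : R)) hq
      simp only [map_pow, map_sub, map_add, map_mul, map_one, map_ofNat,
        Polynomial.aeval_X] at hu
      rw [hu]
      exact (deltaAddSubgroup R).add_mem (hn u) (Delta.aeval_mul_mem h2 u q)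
    · intro hx
      simpa using hx (-1)
end

section
/- Let R be a (2n−1)-ΔU ring for some n ≥ 1. Then R is an exchange ring if and only if R is a clean ring. -/
/-- A ring is exchange if for each `a` there is an idempotent `e ∈ aR` with
`1 - e ∈ (1 - a)R`. -/
def IsExchangeRing (R : Type*) [Ring R] : Prop :=
  ∀ a : R, ∃ e : R, IsIdempotentElem e ∧ (∃ r : R, e = a * r) ∧
    (∃ s : R, 1 - e = (1 - a) * s)

/-- A ring is clean if every element is the sum of an idempotent and a unit. -/
def IsCleanRing (R : Type*) [Ring R] : Prop :=
  ∀ a : R, ∃ e u : R, IsIdempotentElem e ∧ IsUnit u ∧ a = e + u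

namespace Delta

variable {R : Type*} [Ring R]

theorem units_mul_mem_s18 {a : R} (ha : a ∈ Delta R) (u : Rˣ) : (u : R) * a ∈ Delta R := by
  intro v
  simpa [mul_assoc] using ha (v * u)

theorem neg_mem {a : R} (ha : a ∈ Delta R) : -a ∈ Delta R := by
  simpa using units_mul_mem_s18 ha (-1)

theorem add_mem {a b : R} (ha : a ∈ Delta R) (hb : b ∈ Delta R) : a + b ∈ Delta R := by
  intro u
  obtain ⟨v, hv⟩ := ha u
  have key : 1 - (u : R) * (a + b) = v * (1 - ((v⁻¹ * u : Rˣ) : R) * b) := by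
    rw [mul_sub, Units.val_mul, ← mul_assoc, ← mul_assoc, Units.mul_inv, hv]
    noncomm_ring
  rw [key]
  exact v.isUnit.mul (hb _)

theorem sub_mem {a b : R} (ha : a ∈ Delta R) (hb : b ∈ Delta R) : a - b ∈ Delta R := by
  simpa [sub_eq_add_neg] using add_mem ha (neg_mem hb)

theorem zero_mem : (0 : R) ∈ Delta R := fun u => by simp

theorem nsmul_mem {a : R} (ha : a ∈ Delta R) (m : ℕ) : m • a ∈ Delta R := by
  induction m with
  | zero => simpa using zero_mem
  | succ m ih => exact succ_nsmul a m ▸ add_mem ih ha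

end Delta

theorem one_add_pow_of_mul_self_eq_zero {R : Type*} [Ring R] {a : R} (ha : a * a = 0) (k : ℕ) :
    (1 + a) ^ k = 1 + k • a := by
  induction k with
  | zero => simp
  | succ k ih => simp [pow_succ, ih, mul_add, add_mul, mul_assoc, ha]; abel

theorem isUnit_one_add_of_mul_self_eq_zero {R : Type*} [Ring R] {a : R} (ha : a * a = 0) :
    IsUnit (1 + a) :=
  ⟨⟨1 + a, 1 - a, by simp [mul_sub, add_mul, ha], by simp [mul_add, sub_mul, ha]⟩, rfl⟩

theorem IsNDeltaU.mem_delta_of_mul_self_eq_zero {R : Type*} [Ring R] {m : ℕ}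
    (h : IsNDeltaU R (2 * m + 1)) {a : R} (ha : a * a = 0) : a ∈ Delta R := by
  have two_mem : (2 : R) ∈ Delta R := by
    have key := Delta.neg_mem (h (-1))
    have : -((((-1 : Rˣ) : R)) ^ (2 * m + 1) - 1) = 2 := by
      simp [pow_succ, pow_mul]; norm_num
    rwa [this] at key
  obtain ⟨u, hu⟩ := isUnit_one_add_of_mul_self_eq_zero ha
  have two_mul_mem : 2 • a ∈ Delta R := by
    have key := Delta.sub_mem (Delta.units_mul_mem_s18 two_mem u) two_mem
    have : (u : R) * 2 - 2 = 2 • a := by rw [hu, add_mul, two_nsmul, mul_two a]; simp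
    rwa [this] at key
  have odd_mem := h u
  rw [hu, one_add_pow_of_mul_self_eq_zero ha, add_sub_cancel_left] at odd_mem
  have key := Delta.sub_mem odd_mem (Delta.nsmul_mem two_mul_mem m)
  have : (2 * m + 1) • a - m • 2 • a = a := by
    rw [add_nsmul, one_nsmul, mul_comm, mul_nsmul']
    abel
  rwa [this] at key

/-- If square-zero elements lie in `Δ(R)`, an idempotent `a * r` with `a * a = 0` vanishes:
otherwise it would generate a nonzero corner containing `2 × 2` matrix units. -/
theorem mul_eq_zero_of_isIdempotentElem_of_forall_mem_delta {R : Type*} [Ring R]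
    (h : ∀ a : R, a * a = 0 → a ∈ Delta R) {a r : R} (ha : a * a = 0)
    (hr : IsIdempotentElem (a * r)) : a * r = 0 := by
  have ha' (x : R) : a * (a * x) = 0 := by rw [← mul_assoc, ha, zero_mul]
  have hr' : a * (r * (a * r)) = a * r := by simpa [mul_assoc] using hr.eq
  have hr'' (x : R) : a * (r * (a * (r * x))) = a * (r * x) := by
    simpa [mul_assoc] using congrArg (· * x) hr.eq
  let c := a * r * a
  let d := r * a * r * (1 - r * a * r * a)
  let f := a * r * (1 - r * a * r * a)
  have hc : c * c = 0 := by simp [c, mul_assoc, ha']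
  have hd : d * d = 0 := by simp [d, mul_assoc, mul_sub, sub_mul, hr', hr'']
  have fixed : (1 - (c + d)) * (f + d) = 0 := by
    simp [c, d, f, mul_assoc, mul_sub, sub_mul, mul_add, add_mul, ha', hr', hr'']
    abel
  have unit : IsUnit (1 - (c + d)) := by
    simpa using Delta.add_mem (h c hc) (h d hd) 1
  have zero : f + d = 0 := unit.mul_right_eq_zero.mp fixed
  have key : f * (f + d) * (a * r) = a * r := by
    simp [d, f, mul_assoc, mul_sub, sub_mul, mul_add, ha', hr', hr'']
  simpa [zero] using key.symm

/-- An element of an exchange ring lies in the Jacobson radical as soon as the right ideal it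
generates contains no nonzero idempotent. -/
theorem IsExchangeRing.mem_jacobson {R : Type*} [Ring R] (hR : IsExchangeRing R) {a : R}
    (ha : ∀ r : R, IsIdempotentElem (a * r) → a * r = 0) : a ∈ Ring.jacobson R := by
  have right_inv (r : R) : ∃ s, (1 - a * r) * s = 1 := by
    obtain ⟨e, he, ⟨t, ht⟩, s, hs⟩ := hR (a * r)
    have : e = 0 := by
      rw [ht, mul_assoc] at he ⊢
      exact ha _ he
    exact ⟨s, by rw [← hs, this, sub_zero]⟩
  have left_inv (r : R) : ∃ s, s * (1 - a * r) = 1 := by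
    obtain ⟨s, hs⟩ := right_inv r
    obtain ⟨t, ht⟩ := right_inv (-(r * s))
    have hs' : 1 - a * -(r * s) = s := by
      rw [← hs]; noncomm_ring
    rw [hs'] at ht
    have : 1 - a * r = t := left_inv_eq_right_inv hs ht
    exact ⟨s, by rw [this, ht]⟩
  rw [← Ideal.jacobson_bot, Ideal.mem_jacobson_iff]
  intro r
  obtain ⟨s, hs⟩ := left_inv (-r)
  refine ⟨1 - r * s * a, ?_⟩
  rw [Ideal.mem_bot]
  have : (1 - r * s * a) * r * a + (1 - r * s * a) - 1 = r * (1 - s * (1 - a * -r)) * a := by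
    noncomm_ring
  rw [this, hs]; simp

theorem isUnit_of_quotient_jacobson_eq_one {R : Type*} [Ring R] {x : R}
    (hx : Ideal.Quotient.mk (Ring.jacobson R) x = 1) : IsUnit x := by
  have left_inv {x : R} (hx : Ideal.Quotient.mk (Ring.jacobson R) x = 1) : ∃ y, y * x = 1 := by
    rw [← map_one (Ideal.Quotient.mk (Ring.jacobson R)), Ideal.Quotient.eq,
      ← Ideal.jacobson_bot] at hx
    obtain ⟨y, hy⟩ := Ideal.exists_mul_sub_mem_of_sub_one_mem_jacobson x hx
    exact ⟨y, sub_eq_zero.mp hy⟩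
  obtain ⟨y, hy⟩ := left_inv hx
  have hy' : Ideal.Quotient.mk (Ring.jacobson R) y = 1 := by
    simpa [hx] using congrArg (Ideal.Quotient.mk (Ring.jacobson R)) hy
  obtain ⟨z, hz⟩ := left_inv hy'
  have : z = x := left_inv_eq_right_inv hz hy
  exact ⟨⟨x, y, this ▸ hz, hy⟩, rfl⟩

/-- An exchange ring whose idempotents are central modulo the Jacobson radical is clean. -/
theorem IsExchangeRing.isCleanRing_of_commute {R : Type*} [Ring R] (hR : IsExchangeRing R)
    (hcomm : ∀ e : R, IsIdempotentElem e → ∀ x : R,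
      Commute (Ideal.Quotient.mk (Ring.jacobson R) e) (Ideal.Quotient.mk (Ring.jacobson R) x)) :
    IsCleanRing R := by
  intro a
  obtain ⟨e, he, ⟨r, hr⟩, s, hs⟩ := hR a
  refine ⟨1 - e, a - (1 - e), he.one_sub, ?_, by abel⟩
  set π := Ideal.Quotient.mk (Ring.jacobson R)
  set x := a - (1 - e) with hx
  have hxy : π (x * (r * e - s * (1 - e))) = 1 := by
    have h₁ : x * (r * e - s * (1 - e)) =
        a * r * e + (1 - a) * s * (1 - e) - (1 - e) * r * e - e * s * (1 - e) := by
      rw [hx]; noncomm_ring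
    have h₂ : π ((1 - e) * r * e) = 0 := by
      rw [mul_assoc, map_mul, map_mul, ← (hcomm e he r).eq, ← map_mul, ← map_mul, ← mul_assoc,
        he.one_sub_mul_self, zero_mul, map_zero]
    have h₃ : π (e * s * (1 - e)) = 0 := by
      rw [map_mul, map_mul, (hcomm e he s).eq, ← map_mul, ← map_mul, mul_assoc,
        he.mul_one_sub_self, mul_zero, map_zero]
    rw [h₁, ← hr, ← hs, he.eq, he.one_sub.eq, map_sub, map_sub, h₂, h₃]
    simp
  obtain ⟨v, hv⟩ := isUnit_of_quotient_jacobson_eq_one hxy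
  obtain ⟨y, hy⟩ : ∃ y, x * y = 1 :=
    ⟨(r * e - s * (1 - e)) * ↑v⁻¹, by rw [← mul_assoc, ← hv, Units.mul_inv]⟩
  have hidem : IsIdempotentElem (y * x) := by
    rw [IsIdempotentElem, mul_assoc, ← mul_assoc x, hy, one_mul]
  have hyx : π (y * x) = 1 := by
    calc π (y * x) = π (y * x) * π x * π y := by rw [mul_assoc, ← map_mul π x, hy]; simp
      _ = π (x * y * (x * y)) := by rw [(hcomm _ hidem x).eq]; simp only [map_mul, mul_assoc]
      _ = 1 := by simp [hy]
  obtain ⟨w, hw⟩ := isUnit_of_quotient_jacobson_eq_one hyx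
  have hleft : (↑w⁻¹ * y) * x = 1 := by rw [mul_assoc, ← hw, Units.inv_mul]
  have : ↑w⁻¹ * y = y := left_inv_eq_right_inv hleft hy
  exact ⟨⟨x, y, hy, this ▸ hleft⟩, rfl⟩

theorem IsExchangeRing.isCleanRing_of_forall_mem_delta {R : Type*} [Ring R]
    (hR : IsExchangeRing R) (h : ∀ a : R, a * a = 0 → a ∈ Delta R) : IsCleanRing R := by
  have mem {a : R} (ha : a * a = 0) : Ideal.Quotient.mk (Ring.jacobson R) a = 0 :=
    Ideal.Quotient.eq_zero_iff_mem.mpr <| hR.mem_jacobson fun _ hr =>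
      mul_eq_zero_of_isIdempotentElem_of_forall_mem_delta h ha hr
  refine hR.isCleanRing_of_commute fun e he x => ?_
  have h₁ : (e * x * (1 - e)) * (e * x * (1 - e)) = 0 := by
    rw [show (e * x * (1 - e)) * (e * x * (1 - e)) = e * x * ((1 - e) * e) * x * (1 - e) by
      noncomm_ring, he.one_sub_mul_self]
    simp
  have h₂ : ((1 - e) * x * e) * ((1 - e) * x * e) = 0 := by
    rw [show ((1 - e) * x * e) * ((1 - e) * x * e) = (1 - e) * x * (e * (1 - e)) * x * e by
      noncomm_ring, he.mul_one_sub_self]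
    simp
  have key : e * x - x * e = e * x * (1 - e) - (1 - e) * x * e := by noncomm_ring
  rw [Commute, SemiconjBy, ← sub_eq_zero, ← map_mul, ← map_mul, ← map_sub, key, map_sub,
    mem h₁, mem h₂, sub_zero]

theorem IsCleanRing.isExchangeRing {R : Type*} [Ring R] (hR : IsCleanRing R) :
    IsExchangeRing R := by
  intro a
  obtain ⟨e, _, he, ⟨u, rfl⟩, rfl⟩ := hR a
  refine ⟨u * (1 - e) * ↑u⁻¹, ?_, ⟨(1 - e) * ↑u⁻¹, ?_⟩, -(e * ↑u⁻¹), ?_⟩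
  · rw [IsIdempotentElem, show (u : R) * (1 - e) * ↑u⁻¹ * (u * (1 - e) * ↑u⁻¹) =
      u * ((1 - e) * (↑u⁻¹ * u) * (1 - e)) * ↑u⁻¹ by simp only [mul_assoc], Units.inv_mul,
      mul_one, he.one_sub.eq]
  · rw [add_mul, ← mul_assoc e, he.mul_one_sub_self, zero_mul, zero_add, mul_assoc]
  · have : (1 - (e + u)) * -(e * (↑u⁻¹ : R)) = (e * e - e) * ↑u⁻¹ + u * e * ↑u⁻¹ := by
      noncomm_ring
    rw [this, he.eq, mul_sub, sub_mul, mul_one, Units.mul_inv]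
    simp

/-- A `(2n-1)`-ΔU ring is exchange iff it is clean. -/
theorem exchange_iff_clean_of_isNDeltaU (R : Type*) [Ring R] (n : ℕ) (hn : 1 ≤ n)
    (h : IsNDeltaU R (2 * n - 1)) :
    IsExchangeRing R ↔ IsCleanRing R := by
  obtain ⟨m, rfl⟩ := Nat.exists_eq_add_of_le' hn
  have h' : IsNDeltaU R (2 * m + 1) := h
  exact ⟨fun hR => hR.isCleanRing_of_forall_mem_delta fun _ => h'.mem_delta_of_mul_self_eq_zero,
    IsCleanRing.isExchangeRing⟩
end
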